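/- arXiv:2510.09399 — 2 statements merged into one kernel-verified Lean document; each statement's English description precedes it below -/
import Mathlib

section
/- Let (C, d) be a filtered complex over a PID R with finite filtration, and suppose the torsion submodule Tor H_*(C) is finite. Then |Tor E^∞(C)| ≥ |Tor H_*(C)|, where E^∞(C) = ⊕_p G_pH_*(C) is the associated graded of the filtered homology. Moreover, if equality holds, then for each p any torsion element of G_pH_*(C) is represented by a torsion element of H_*(C). -/
open LinearMap Submodule

/-- A *filtered complex* over `R`: a chain complex `(C, d)` together with a direct
sum decomposition `C = ⊕_{i₀ ≤ i ≤ i₁} Cᵢ` (here `G i`), such that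
`d(Cᵢ) ⊆ ⊕_{j ≥ i} Cⱼ`.  (The ambient `ℤ/4`-grading plays no role in the filtered
algebra and is omitted.) -/
structure FilteredCx (R : Type*) (C : Type*) [CommRing R] [AddCommGroup C]
    [Module R C] where
  d : C →ₗ[R] C
  dd : d ∘ₗ d = 0
  G : ℤ → Submodule R C
  internal : DirectSum.IsInternal fun i : ℤ => G i
  i₀ : ℤ
  i₁ : ℤ
  hGlow : ∀ i : ℤ, i < i₀ → G i = ⊥
  hGhigh : ∀ i : ℤ, i₁ < i → G i = ⊥
  hdG : ∀ i : ℤ, (G i).map d ≤ ⨆ j : ℤ, ⨆ _ : i ≤ j, G j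

namespace FilteredCx

variable {R C : Type*} [CommRing R] [AddCommGroup C] [Module R C]

/-- The filtration `F_pC = ⊕_{i ≥ p} Cᵢ`. -/
def F (X : FilteredCx R C) (p : ℤ) : Submodule R C :=
  ⨆ j : ℤ, ⨆ _ : p ≤ j, X.G j

/-- `{x ∈ F_pC : dx ∈ F_{p+r}C}`. -/
def zmod (X : FilteredCx R C) (r : ℕ) (p : ℤ) : Submodule R C :=
  X.F p ⊓ Submodule.comap X.d (X.F (p + r))

/-- `F_{p+1}C + d(F_{p−r+1}C)`. -/
def bmod (X : FilteredCx R C) (r : ℕ) (p : ℤ) : Submodule R C :=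
  X.F (p + 1) ⊔ Submodule.map X.d (X.F (p - r + 1))

/-- The spectral sequence page
`E^r_p(C) = {x ∈ F_pC : dx ∈ F_{p+r}C} / (F_{p+1}C + d(F_{p−r+1}C))`. -/
abbrev Epage (X : FilteredCx R C) (r : ℕ) (p : ℤ) : Type _ :=
  ↥(X.zmod r p) ⧸ Submodule.comap (X.zmod r p).subtype (X.bmod r p)

/-- The class `[x]^r_p ∈ E^r_p(C)` of an element `x ∈ F_pC` with `dx ∈ F_{p+r}C`. -/
def eClass (X : FilteredCx R C) (r : ℕ) (p : ℤ) (x : C) (hx : x ∈ X.zmod r p) :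
    X.Epage r p :=
  Submodule.Quotient.mk ⟨x, hx⟩

/-- The homology `H_*(C) = Ker d / Im d`. -/
abbrev Hmod (X : FilteredCx R C) : Type _ :=
  ↥(LinearMap.ker X.d) ⧸
    Submodule.comap (LinearMap.ker X.d).subtype (LinearMap.range X.d)

/-- The induced filtration `F_pH_*(C) = {[x] ∈ H_*(C) : dx = 0, x ∈ F_pC}`. -/
def FH (X : FilteredCx R C) (p : ℤ) : Submodule R X.Hmod :=
  Submodule.map
    (Submodule.comap (LinearMap.ker X.d).subtype (LinearMap.range X.d)).mkQ
    (Submodule.comap (LinearMap.ker X.d).subtype (X.F p))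

/-- The associated graded piece `G_pH_*(C) = F_pH_*(C)/F_{p+1}H_*(C)`. -/
abbrev GH (X : FilteredCx R C) (p : ℤ) : Type _ :=
  ↥(X.FH p) ⧸ Submodule.comap (X.FH p).subtype (X.FH (p + 1))

end FilteredCx

section Helpers

variable {R M N : Type*} [CommRing R] [AddCommGroup M] [Module R M]
  [AddCommGroup N] [Module R N]

theorem aux_card (S : Submodule R M) (f : M →ₗ[R] N) :
    Nat.card S = Nat.card ↥(S ⊓ LinearMap.ker f) * Nat.card ↥(S.map f) := by
  let g : S →ₗ[R] N := f ∘ₗ S.subtype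
  have h1 := Submodule.card_eq_card_quotient_mul_card (LinearMap.ker g)
  have h2 : Nat.card (S ⧸ LinearMap.ker g) = Nat.card ↥(S.map f) := by
    have : LinearMap.range g = S.map f := by
      simp [g, LinearMap.range_comp]
    rw [← this]
    exact Nat.card_congr g.quotKerEquivRange.toEquiv
  have h3 : Nat.card (LinearMap.ker g) = Nat.card ↥(S ⊓ LinearMap.ker f) := by
    have e : LinearMap.ker g = Submodule.comap S.subtype (S ⊓ LinearMap.ker f) := by
      ext x
      simp [g]
    rw [e]
    exact Nat.card_congr (Submodule.comapSubtypeEquivOfLe inf_le_left).toEquiv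
  rw [h1, h2, h3]

open DirectSum

/-- graded pieces of a filtration -/
abbrev auxG (P : ℤ → Submodule R M) (p : ℤ) : Type _ :=
  ↥(P p) ⧸ Submodule.comap (P p).subtype (P (p + 1))

/-- image of a submodule in the graded piece -/
def auxA (P : ℤ → Submodule R M) (T : Submodule R M) (p : ℤ) : Submodule R (auxG P p) :=
  Submodule.map (Submodule.comap (P p).subtype (P (p + 1))).mkQ
    (Submodule.comap (P p).subtype T)

/-- elements of the associated graded supported in degrees at least `p` with components in `auxA` -/
def auxB (P : ℤ → Submodule R M) (T : Submodule R M) (p : ℤ) :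
    Submodule R (⨁ q : ℤ, auxG P q) where
  carrier := {x | ∀ q, x q ∈ auxA P T q ∧ (q < p → x q = 0)}
  zero_mem' := fun q => by simp
  add_mem' := by
    intro a b ha hb q
    refine ⟨?_, fun h => ?_⟩
    · rw [DirectSum.add_apply]
      exact add_mem (ha q).1 (hb q).1
    · rw [DirectSum.add_apply, (ha q).2 h, (hb q).2 h, add_zero]
  smul_mem' := by
    intro c a ha q
    refine ⟨?_, fun h => ?_⟩
    · rw [DirectSum.smul_apply]
      exact Submodule.smul_mem _ _ (ha q).1
    · rw [DirectSum.smul_apply, (ha q).2 h, smul_zero]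

theorem mem_auxB {P : ℤ → Submodule R M} {T : Submodule R M} {p : ℤ}
    {x : ⨁ q : ℤ, auxG P q} :
    x ∈ auxB P T p ↔ ∀ q, x q ∈ auxA P T q ∧ (q < p → x q = 0) := Iff.rfl

theorem card_T_step (P : ℤ → Submodule R M) (hP : Antitone P) (T : Submodule R M) (p : ℤ) :
    Nat.card ↥(T ⊓ P p) = Nat.card ↥(T ⊓ P (p + 1)) * Nat.card (auxA P T p) := by
  have h := aux_card (Submodule.comap (P p).subtype T)
    (Submodule.comap (P p).subtype (P (p + 1))).mkQ
  have e1 : Nat.card (Submodule.comap (P p).subtype T) = Nat.card ↥(T ⊓ P p) := by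
    have : Submodule.comap (P p).subtype T = Submodule.comap (P p).subtype (T ⊓ P p) := by
      ext x; simp
    rw [this]
    exact Nat.card_congr (Submodule.comapSubtypeEquivOfLe inf_le_right).toEquiv
  have e2 : Nat.card ↥(Submodule.comap (P p).subtype T ⊓
      LinearMap.ker (Submodule.comap (P p).subtype (P (p + 1))).mkQ)
      = Nat.card ↥(T ⊓ P (p + 1)) := by
    rw [Submodule.ker_mkQ, ← Submodule.comap_inf]
    exact Nat.card_congr (Submodule.comapSubtypeEquivOfLe
      (inf_le_right.trans (hP (by omega)))).toEquiv
  rw [e1, e2] at h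
  exact h

theorem card_B_step (P : ℤ → Submodule R M) (T : Submodule R M) (p : ℤ) :
    Nat.card ↥(auxB P T p) = Nat.card ↥(auxB P T (p + 1)) * Nat.card (auxA P T p) := by
  have h := aux_card (M := ⨁ q : ℤ, auxG P q) (N := auxG P p)
    (auxB P T p) (DirectSum.component R ℤ (fun q => auxG P q) p)
  have e1 : auxB P T p ⊓ LinearMap.ker (DirectSum.component R ℤ (fun q => auxG P q) p)
      = auxB P T (p + 1) := by
    ext x
    rw [Submodule.mem_inf, mem_auxB, mem_auxB, LinearMap.mem_ker]
    constructor
    · rintro ⟨h1, h2⟩ q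
      refine ⟨(h1 q).1, fun hq => ?_⟩
      rcases eq_or_ne q p with rfl | hne
      · exact h2
      · exact (h1 q).2 (by omega)
    · intro h1
      exact ⟨fun q => ⟨(h1 q).1, fun hq => (h1 q).2 (by omega)⟩, (h1 p).2 (by omega)⟩
  have e2 : (auxB P T p).map (DirectSum.component R ℤ (fun q => auxG P q) p) = auxA P T p := by
    ext y
    constructor
    · rintro ⟨x, hx, rfl⟩
      exact (hx p).1
    · intro hy
      refine ⟨DirectSum.lof R ℤ (fun q => auxG P q) p y, ?_, DirectSum.component.lof_self ..⟩
      intro q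
      rcases eq_or_ne p q with rfl | hne
      · rw [DirectSum.lof_apply]
        exact ⟨hy, fun h => absurd h (lt_irrefl _)⟩
      · rw [DirectSum.lof_eq_of, DirectSum.of_eq_of_ne _ _ _ hne.symm]
        exact ⟨zero_mem _, fun _ => rfl⟩
  rw [e1, e2] at h
  exact h

theorem auxG_eq_zero (P : ℤ → Submodule R M) (p : ℤ) (h : P p ≤ P (p + 1)) (x : auxG P p) :
    x = 0 := by
  obtain ⟨y, rfl⟩ := Submodule.Quotient.mk_surjective _ x
  exact (Submodule.Quotient.mk_eq_zero _).2 (h y.2)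

theorem card_T_eq (P : ℤ → Submodule R M) (hP : Antitone P) (T : Submodule R M)
    (b : ℤ) (hb : ∀ p, b < p → P p = ⊥) (n : ℕ) :
    Nat.card ↥(T ⊓ P (b + 1 - n)) = Nat.card ↥(auxB P T (b + 1 - n)) := by
  induction n with
  | zero =>
    have h1 : T ⊓ P (b + 1 - (0 : ℕ)) = ⊥ := by rw [hb _ (by simp)]; simp
    have h2 : auxB P T (b + 1 - (0 : ℕ)) = ⊥ := by
      rw [eq_bot_iff]
      intro x hx
      rw [Submodule.mem_bot]
      refine DFinsupp.ext fun q => ?_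
      by_cases hq : q < b + 1 - (0 : ℕ)
      · exact (hx q).2 hq
      · exact auxG_eq_zero P q (by rw [hb q (by push_cast at hq; omega)]; exact bot_le) _
    rw [h1, h2]
    simp
  | succ n ih =>
    rw [card_T_step P hP, card_B_step]
    have : b + 1 - ((n + 1 : ℕ) : ℤ) + 1 = b + 1 - n := by push_cast; ring
    rw [← this] at ih
    rw [ih]

theorem aux_main (P : ℤ → Submodule R M) (hP : Antitone P) (a b : ℤ)
    (ha : ∀ p, p ≤ a → P p = ⊤) (hb : ∀ p, b < p → P p = ⊥)
    (htor : Finite (Submodule.torsion R M)) :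
    ∃ A : Submodule R (⨁ q : ℤ, auxG P q), A ≤ Submodule.torsion R (⨁ q : ℤ, auxG P q) ∧
      Finite A ∧ Nat.card A = Nat.card (Submodule.torsion R M) ∧
      ∀ x ∈ A, ∀ q, x q ∈ auxA P (Submodule.torsion R M) q := by
  classical
  set T := Submodule.torsion R M with hT
  obtain ⟨n, hn⟩ : ∃ n : ℕ, b + 1 - (n : ℤ) ≤ a := ⟨(b + 1 - a).toNat, by omega⟩
  have hc := card_T_eq P hP T b hb n
  rw [ha _ hn, inf_top_eq] at hc
  have hpos : 0 < Nat.card T := Nat.card_pos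
  refine ⟨auxB P T (b + 1 - n), ?_, Nat.finite_of_card_ne_zero (by omega), hc.symm,
    fun x hx q => (hx q).1⟩
  intro x hx
  rw [← DirectSum.sum_support_of x]
  refine Submodule.sum_mem _ fun q _ => ?_
  obtain ⟨y, hy, hyx⟩ := (hx q).1
  obtain ⟨c, hcy⟩ := (Submodule.mem_torsion_iff _).1 (show (y : M) ∈ Submodule.torsion R M from hy)
  rw [Submodule.mem_torsion_iff]
  refine ⟨c, ?_⟩
  have hy0 : c • y = 0 := Subtype.ext hcy
  rw [← hyx, ← DirectSum.lof_eq_of R, Submonoid.smul_def, ← map_smul, ← map_smul]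
  rw [Submonoid.smul_def] at hy0
  rw [hy0, map_zero, map_zero]

end Helpers

namespace FilteredCx

variable {R C : Type*} [CommRing R] [AddCommGroup C] [Module R C]

theorem F_anti (X : FilteredCx R C) : Antitone X.F := by
  intro p q h
  exact iSup_mono fun j => iSup_le fun hj => le_iSup_of_le (h.trans hj) le_rfl

theorem FH_anti (X : FilteredCx R C) : Antitone X.FH := fun _ _ h =>
  Submodule.map_mono (Submodule.comap_mono (X.F_anti h))

theorem FH_top (X : FilteredCx R C) (p : ℤ) (hp : p ≤ X.i₀) : X.FH p = ⊤ := by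
  have h : X.F p = ⊤ := by
    rw [eq_top_iff, ← X.internal.submodule_iSup_eq_top]
    refine iSup_le fun j => ?_
    by_cases hj : p ≤ j
    · exact le_iSup_of_le j (le_iSup_of_le hj le_rfl)
    · rw [X.hGlow j (by omega)]
      exact bot_le
  rw [FH, h, Submodule.comap_top, Submodule.map_top, Submodule.range_mkQ]

theorem FH_bot (X : FilteredCx R C) (p : ℤ) (hp : X.i₁ < p) : X.FH p = ⊥ := by
  have h : X.F p = ⊥ := by
    rw [eq_bot_iff]
    refine iSup_le fun j => iSup_le fun hj => ?_
    rw [X.hGhigh j (by omega)]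
  rw [FH, h, eq_bot_iff]
  rintro _ ⟨x, hx, rfl⟩
  have : x = 0 := Subtype.ext hx
  rw [this, map_zero]
  exact zero_mem _

end FilteredCx

open DirectSum in
/-- If `Tor H_*(C)` is finite then `|Tor E^∞(C)| ≥ |Tor H_*(C)|`, where
`E^∞(C) = ⊕_p G_pH_*(C)`; and if equality holds then every torsion element of
`G_pH_*(C)` is represented by a torsion element of `H_*(C)`. -/
theorem stmt14 {R C : Type*} [CommRing R] [IsDomain R] [IsPrincipalIdealRing R]
    [AddCommGroup C] [Module R C] [Module.Finite R C] [Module.Free R C]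
    (X : FilteredCx R C)
    (htor : Finite (Submodule.torsion R X.Hmod)) :
    Cardinal.mk (Submodule.torsion R X.Hmod) ≤
      Cardinal.mk (Submodule.torsion R (⨁ p : ℤ, X.GH p)) ∧
    (Cardinal.mk (Submodule.torsion R (⨁ p : ℤ, X.GH p)) =
        Cardinal.mk (Submodule.torsion R X.Hmod) →
      ∀ (p : ℤ) (ξ : X.GH p), ξ ∈ Submodule.torsion R (X.GH p) →
        ∃ η : ↥(X.FH p), (η : X.Hmod) ∈ Submodule.torsion R X.Hmod ∧
          (Submodule.Quotient.mk η : X.GH p) = ξ) := by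
  classical
  obtain ⟨A, hA, hfin, hcard, hmem⟩ := aux_main X.FH X.FH_anti X.i₀ X.i₁ X.FH_top X.FH_bot htor
  have hc : Cardinal.mk A = Cardinal.mk (Submodule.torsion R X.Hmod) := by
    rw [← Nat.cast_card, ← Nat.cast_card, hcard]
  refine ⟨?_, ?_⟩
  · rw [← hc]
    exact Cardinal.mk_le_mk_of_subset hA
  · intro heq p ξ hξ
    have hfinE : Finite (Submodule.torsion R (⨁ p : ℤ, X.GH p)) := by
      rw [← Cardinal.lt_aleph0_iff_finite, heq]
      exact Cardinal.lt_aleph0_of_finite _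
    have hAE : A = Submodule.torsion R (⨁ p : ℤ, X.GH p) := by
      apply SetLike.coe_injective
      refine Set.eq_of_subset_of_ncard_le hA ?_ (Set.toFinite _)
      have := congrArg Cardinal.toNat (heq.trans hc.symm)
      exact this.le
    have hx : DirectSum.lof R ℤ (fun p => X.GH p) p ξ ∈ A := by
      rw [hAE]
      obtain ⟨c, hcξ⟩ := (Submodule.mem_torsion_iff _).1 hξ
      rw [Submodule.mem_torsion_iff]
      refine ⟨c, ?_⟩
      rw [Submonoid.smul_def] at hcξ ⊢
      rw [← map_smul, hcξ, map_zero]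
    have h := hmem _ hx p
    rw [DirectSum.lof_apply] at h
    obtain ⟨η, hη, rfl⟩ := h
    exact ⟨η, hη, rfl⟩
end

section
/- Let f : C → C' be a filtered chain homotopy equivalence of filtered complexes (degree 0, with degree-0 filtered homotopies), and fix r₀ > 0. Then the spectral sequence of C degenerates at r₀ if and only if the spectral sequence of C' degenerates at r₀. -/
open LinearMap Submodule

theorem FilteredCx.F_anti_s17 {R C : Type*} [CommRing R] [AddCommGroup C] [Module R C]
    (X : FilteredCx R C) {p q : ℤ} (h : p ≤ q) : X.F q ≤ X.F p := by
  unfold FilteredCx.F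
  refine iSup_le fun j => iSup_le fun hj => ?_
  exact le_iSup_of_le j (le_iSup_of_le (h.trans hj) le_rfl)

theorem FilteredCx.eClass_eq_zero {R C : Type*} [CommRing R] [AddCommGroup C] [Module R C]
    (X : FilteredCx R C) (r : ℕ) (p : ℤ) (x : C) (hx : x ∈ X.zmod r p) :
    X.eClass r p x hx = 0 ↔ x ∈ X.bmod r p := by
  unfold FilteredCx.eClass
  rw [Submodule.Quotient.mk_eq_zero]
  rfl

theorem FilteredCx.degen_transfer {R C C' : Type*} [CommRing R]
    [AddCommGroup C] [Module R C] [AddCommGroup C'] [Module R C']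
    (X : FilteredCx R C) (Y : FilteredCx R C')
    (f : C →ₗ[R] C') (hf : Y.d ∘ₗ f = f ∘ₗ X.d)
    (hfF : ∀ p : ℤ, (X.F p).map f ≤ Y.F p)
    (g : C' →ₗ[R] C) (hg : X.d ∘ₗ g = g ∘ₗ Y.d)
    (hgF : ∀ p : ℤ, (Y.F p).map g ≤ X.F p)
    (Ψ : C' →ₗ[R] C') (hΨF : ∀ p : ℤ, (Y.F p).map Ψ ≤ Y.F p)
    (hΨ : f ∘ₗ g - LinearMap.id = Ψ ∘ₗ Y.d + Y.d ∘ₗ Ψ)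
    (r₀ : ℕ) (hr₀ : 0 < r₀)
    (H : ∀ (r : ℕ), r₀ ≤ r → ∀ (p : ℤ) (x : C) (_ : x ∈ X.zmod r p)
        (hdx : X.d x ∈ X.zmod r (p + r)),
        X.eClass r (p + r) (X.d x) hdx = 0) :
    ∀ (r : ℕ), r₀ ≤ r → ∀ (p : ℤ) (y : C') (_ : y ∈ Y.zmod r p)
        (hdy : Y.d y ∈ Y.zmod r (p + r)),
        Y.eClass r (p + r) (Y.d y) hdy = 0 := by
  intro r hr p y hy hdy
  have hf' : ∀ x, Y.d (f x) = f (X.d x) := fun x => LinearMap.congr_fun hf x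
  have hg' : ∀ x, X.d (g x) = g (Y.d x) := fun x => LinearMap.congr_fun hg x
  have hXdd : ∀ x, X.d (X.d x) = 0 := fun x => LinearMap.congr_fun X.dd x
  have hYdd : ∀ x, Y.d (Y.d x) = 0 := fun x => LinearMap.congr_fun Y.dd x
  have hdyF : Y.d y ∈ Y.F (p + r) := hy.2
  have hgyF : X.d (g y) ∈ X.F (p + r) := by
    rw [hg']
    exact hgF _ (Submodule.mem_map_of_mem hdyF)
  have hx : g y ∈ X.zmod r p := ⟨hgF _ (Submodule.mem_map_of_mem hy.1), hgyF⟩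
  have hdx : X.d (g y) ∈ X.zmod r (p + r) := by
    refine ⟨hgyF, ?_⟩
    rw [SetLike.mem_coe, Submodule.mem_comap, hXdd]
    exact Submodule.zero_mem _
  have h := (X.eClass_eq_zero r (p + r) _ hdx).1 (H r hr p (g y) hx hdx)
  rw [FilteredCx.eClass_eq_zero]
  unfold FilteredCx.bmod at h ⊢
  obtain ⟨a, ha, b, ⟨c, hc, rfl⟩, hab⟩ := Submodule.mem_sup.1 h
  have h1 := LinearMap.congr_fun hΨ (Y.d y)
  simp only [LinearMap.sub_apply, LinearMap.add_apply, LinearMap.comp_apply, LinearMap.id_apply,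
    hYdd, map_zero, zero_add] at h1
  rw [← hg', ← hab, map_add, ← hf'] at h1
  refine Submodule.mem_sup.2 ⟨f a, hfF _ (Submodule.mem_map_of_mem ha), _,
    ⟨f c - Ψ (Y.d y), ?_, rfl⟩, ?_⟩
  · refine Submodule.sub_mem _ (hfF _ (Submodule.mem_map_of_mem hc)) ?_
    exact Y.F_anti_s17 (by omega) (hΨF _ (Submodule.mem_map_of_mem hdyF))
  · rw [map_sub, ← h1]
    abel

/-- If `f : C → C'` is a degree-0 filtered chain homotopy equivalence
(with homotopy inverse `g` and degree-0 filtered homotopies `Φ, Ψ`), then for any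
`r₀ > 0` the spectral sequence of `C` degenerates at `r₀` iff that of `C'` does. -/
theorem stmt17 {R C C' : Type*} [CommRing R] [IsDomain R] [IsPrincipalIdealRing R]
    [AddCommGroup C] [Module R C] [AddCommGroup C'] [Module R C']
    [Module.Finite R C] [Module.Free R C] [Module.Finite R C'] [Module.Free R C']
    (X : FilteredCx R C) (Y : FilteredCx R C')
    (f : C →ₗ[R] C') (hf : Y.d ∘ₗ f = f ∘ₗ X.d)
    (hfF : ∀ p : ℤ, (X.F p).map f ≤ Y.F p)
    (g : C' →ₗ[R] C) (hg : X.d ∘ₗ g = g ∘ₗ Y.d)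
    (hgF : ∀ p : ℤ, (Y.F p).map g ≤ X.F p)
    (Φ : C →ₗ[R] C) (hΦF : ∀ p : ℤ, (X.F p).map Φ ≤ X.F p)
    (hΦ : g ∘ₗ f - LinearMap.id = Φ ∘ₗ X.d + X.d ∘ₗ Φ)
    (Ψ : C' →ₗ[R] C') (hΨF : ∀ p : ℤ, (Y.F p).map Ψ ≤ Y.F p)
    (hΨ : f ∘ₗ g - LinearMap.id = Ψ ∘ₗ Y.d + Y.d ∘ₗ Ψ)
    (r₀ : ℕ) (hr₀ : 0 < r₀) :
    (∀ (r : ℕ), r₀ ≤ r → ∀ (p : ℤ) (x : C) (_ : x ∈ X.zmod r p)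
        (hdx : X.d x ∈ X.zmod r (p + r)),
        X.eClass r (p + r) (X.d x) hdx = 0) ↔
    (∀ (r : ℕ), r₀ ≤ r → ∀ (p : ℤ) (y : C') (_ : y ∈ Y.zmod r p)
        (hdy : Y.d y ∈ Y.zmod r (p + r)),
        Y.eClass r (p + r) (Y.d y) hdy = 0) := by
  exact ⟨X.degen_transfer Y f hf hfF g hg hgF Ψ hΨF hΨ r₀ hr₀,
    Y.degen_transfer X g hg hgF f hf hfF Φ hΦF hΦ r₀ hr₀⟩
end
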